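/- Let n ≥ 1, p ≥ 1, and let A, B₁, …, B_p be n × n skew-Hermitian complex matrices (Mᴴ = −M) with operator norm ‖A‖ ≤ 1. Let u : ℝ → Fin p → ℝ be continuous, and let X : ℝ → ℂⁿ be differentiable with ‖X 0‖ = 1 and, for all t, X′(t) = A · X(t) + ∑_{i} uᵢ(t) • (Bᵢ · X(t)). Let G be the topological closure in U(n) of the subgroup generated by {exp(s • Bᵢ) : s ∈ ℝ, i ∈ Fin p}. Then for every T with 0 ≤ T ≤ π, inf_{g ∈ G} ‖g · X(0) − X(T)‖ ≤ 2 sin(T/2). -/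

import Mathlib

open scoped Matrix

open InnerProductGeometry Filter Topology in
lemma aux_angle_eq {V : Type*} [NormedAddCommGroup V] [InnerProductSpace ℝ V] {x y : V}
    (hx : ‖x‖ = 1) (hy : ‖y‖ = 1) : angle x y = 2 * Real.arcsin (‖x - y‖ / 2) := by
  have h0 := angle_nonneg x y
  have h1 := angle_le_pi x y
  have h2 := norm_sub_sq_eq_norm_sq_add_norm_sq_sub_two_mul_norm_mul_norm_mul_cos_angle x y
  rw [hx, hy] at h2
  have h3 : ‖x - y‖ = 2 * Real.sin (angle x y / 2) := by
    have hs : 0 ≤ Real.sin (angle x y / 2) :=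
      Real.sin_nonneg_of_nonneg_of_le_pi (by linarith) (by linarith)
    have hc : Real.cos (angle x y) = 1 - 2 * Real.sin (angle x y / 2) ^ 2 := by
      have := Real.cos_two_mul (angle x y / 2)
      have h5 := Real.sin_sq_add_cos_sq (angle x y / 2)
      rw [show 2 * (angle x y / 2) = angle x y by ring] at this
      linarith
    rw [hc] at h2
    have h4 : ‖x - y‖ ^ 2 = (2 * Real.sin (angle x y / 2)) ^ 2 := by linarith
    exact (sq_eq_sq₀ (norm_nonneg _) (by positivity)).1 h4
  rw [h3, mul_div_cancel_left₀ _ (by norm_num : (2:ℝ) ≠ 0),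
    Real.arcsin_sin (by linarith) (by linarith)]
  ring

open InnerProductGeometry Filter Topology in
lemma aux_core {V Γ : Type*} [NormedAddCommGroup V] [InnerProductSpace ℝ V] [Group Γ]
    (ρ : Γ → V → V) (h1 : ∀ x, ρ 1 x = x) (hmul : ∀ g h x, ρ (g * h) x = ρ g (ρ h x))
    (hiso : ∀ g x y, ‖ρ g x - ρ g y‖ = ‖x - y‖) (hnorm : ∀ g x, ‖ρ g x‖ = ‖x‖)
    (X : ℝ → V) (hX : ∀ t, ‖X t‖ = 1) (hXc : Continuous X)
    (hd : ∀ t, ∃ W : ℝ → Γ, ∃ v : V, ‖v‖ ≤ 1 ∧ W 0 = 1 ∧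
      HasDerivAt (fun h => ρ (W h) (X (t + h))) v 0) (T : ℝ) (hT : 0 ≤ T) :
    (⨅ g, angle (ρ g (X 0)) (X T)) ≤ T := by
  have hbdd : ∀ t, BddBelow (Set.range fun g => angle (ρ g (X 0)) (X t)) := fun t =>
    ⟨0, by rintro _ ⟨g, rfl⟩; exact angle_nonneg _ _⟩
  set d : ℝ → ℝ := fun t => ⨅ g, angle (ρ g (X 0)) (X t) with hdef
  -- key step inequality
  have key : ∀ t s (w : Γ), d s ≤ d t + angle (X t) (ρ w (X s)) := by
    intro t s w
    rw [← sub_le_iff_le_add]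
    refine le_ciInf fun g => ?_
    rw [sub_le_iff_le_add]
    refine (ciInf_le (hbdd s) (w⁻¹ * g)).trans ?_
    have e : angle (ρ (w⁻¹ * g) (X 0)) (X s) = angle (ρ g (X 0)) (ρ w (X s)) := by
      rw [aux_angle_eq (by rw [hnorm, hX]) (hX s),
        aux_angle_eq (by rw [hnorm, hX]) (by rw [hnorm, hX]), ← hiso w, ← hmul]
      simp
    simp only [e]
    exact angle_le_angle_add_angle _ _ _
  have hcont : Continuous d := by
    rw [continuous_iff_continuousAt]
    intro t
    rw [ContinuousAt, tendsto_iff_dist_tendsto_zero]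
    have hlim : Tendsto (fun s => 2 * Real.arcsin (‖X t - X s‖ / 2)) (𝓝 t) (𝓝 0) := by
      have : Continuous (fun s => 2 * Real.arcsin (‖X t - X s‖ / 2)) :=
        continuous_const.mul (Real.continuous_arcsin.comp
          ((continuous_const.sub hXc).norm.div_const 2))
      simpa using this.tendsto t
    refine squeeze_zero (fun _ => dist_nonneg) (fun s => ?_) hlim
    rw [← aux_angle_eq (hX t) (hX s), Real.dist_eq, abs_le]
    have ha := key t s 1
    have hb := key s t 1
    rw [h1] at ha hb
    rw [angle_comm] at hb
    constructor <;> linarith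
  refine image_le_of_liminf_slope_right_le_deriv_boundary (f := d) (a := 0) (b := T)
    (B := fun x => x) (B' := fun _ => 1) hcont.continuousOn ?_ continuousOn_id
    (fun x _ => (hasDerivAt_id x).hasDerivWithinAt) ?_ ⟨hT, le_rfl⟩
  · refine (ciInf_le (hbdd 0) 1).trans ?_
    rw [h1, angle_self]
    intro h
    simpa [h] using hX 0
  · intro t _ r hr
    apply Eventually.frequently
    obtain ⟨W, v, hv, hW0, hW⟩ := hd t
    obtain ⟨r', hr1, hr2⟩ := exists_between hr
    -- norm estimate
    have e1 : ∀ᶠ h in 𝓝[>] (0:ℝ), ‖ρ (W h) (X (t + h)) - X t‖ ≤ r' * h := by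
      have h2 := hW.isLittleO.def (show 0 < r' - 1 by linarith)
      filter_upwards [nhdsWithin_le_nhds h2, self_mem_nhdsWithin] with h hh hpos
      have hpos' : 0 < h := hpos
      simp only [hW0, h1, add_zero, sub_zero, Real.norm_eq_abs, abs_of_pos hpos'] at hh
      calc ‖ρ (W h) (X (t + h)) - X t‖
          = ‖(ρ (W h) (X (t + h)) - X t - h • v) + h • v‖ := by rw [sub_add_cancel]
        _ ≤ (r' - 1) * h + h * 1 := by
          refine (norm_add_le _ _).trans (add_le_add hh ?_)
          rw [norm_smul, Real.norm_eq_abs, abs_of_pos hpos']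
          gcongr
        _ = r' * h := by ring
    have e2 : ∀ᶠ h in 𝓝[>] (0:ℝ), 2 * Real.arcsin (r' * h / 2) < r * h := by
      have h3 : HasDerivAt (fun h : ℝ => 2 * Real.arcsin (r' * h / 2)) r' 0 := by
        have ha : HasDerivAt (fun h : ℝ => r' * h / 2) (r' / 2) 0 := by
          simpa using ((hasDerivAt_id (0:ℝ)).const_mul r').div_const 2
        have hb := Real.hasDerivAt_arcsin (x := r' * 0 / 2) (by norm_num) (by norm_num)
        have hc := (hb.comp (0:ℝ) ha).const_mul 2
        convert! hc using 1
        norm_num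
        ring
      have h2 := h3.isLittleO.def (show 0 < (r - r') / 2 by linarith)
      filter_upwards [nhdsWithin_le_nhds h2, self_mem_nhdsWithin] with h hh hpos
      have hpos' : 0 < h := hpos
      simp only [mul_zero, zero_div, Real.arcsin_zero, sub_zero, Real.norm_eq_abs,
        abs_of_pos hpos', smul_eq_mul] at hh
      have := (abs_le.1 hh).2
      nlinarith
    have e3 : ∀ᶠ h in 𝓝[>] (0:ℝ), d (t + h) - d t < r * h := by
      filter_upwards [e1, e2] with h ha hb
      have hk := key t (t + h) (W h)
      rw [aux_angle_eq (hX t) (by rw [hnorm, hX]), norm_sub_rev] at hk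
      have : Real.arcsin (‖ρ (W h) (X (t + h)) - X t‖ / 2) ≤ Real.arcsin (r' * h / 2) :=
        Real.monotone_arcsin (by linarith)
      linarith
    have htend : Tendsto (fun z => z - t) (𝓝[>] t) (𝓝[>] 0) := by
      refine tendsto_nhdsWithin_iff.2 ⟨?_, ?_⟩
      · have : Continuous (fun z : ℝ => z - t) := by fun_prop
        have := this.tendsto t
        rw [sub_self] at this
        exact this.mono_left nhdsWithin_le_nhds
      · filter_upwards [self_mem_nhdsWithin] with z hz
        exact sub_pos.2 (Set.mem_Ioi.1 hz)
    filter_upwards [htend.eventually e3, self_mem_nhdsWithin] with z hz hz'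
    have hz' : 0 < z - t := sub_pos.2 hz'
    rw [add_sub_cancel] at hz
    rw [slope_def_field, div_lt_iff₀ hz']
    exact hz

lemma aux_inner_skew {n : ℕ} (M : Matrix (Fin n) (Fin n) ℂ) (hM : Mᴴ = -M)
    (x : EuclideanSpace ℂ (Fin n)) : (inner ℂ x (Matrix.toEuclideanLin M x)).re = 0 := by
  have h : inner ℂ (Matrix.toEuclideanLin Mᴴ x) x = inner ℂ x (Matrix.toEuclideanLin M x) := by
    rw [Matrix.toEuclideanLin_conjTranspose_eq_adjoint, LinearMap.adjoint_inner_left]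
  rw [hM, map_neg, LinearMap.neg_apply, inner_neg_left, ← inner_conj_symm] at h
  have := congrArg Complex.re h
  rw [Complex.neg_re, Complex.conj_re] at this
  linarith

lemma aux_norm_unitary {n : ℕ} (g : Matrix.unitaryGroup (Fin n) ℂ)
    (x : EuclideanSpace ℂ (Fin n)) :
    ‖Matrix.toEuclideanLin (g : Matrix (Fin n) (Fin n) ℂ) x‖ = ‖x‖ := by
  have h : inner ℂ (Matrix.toEuclideanLin (g : Matrix (Fin n) (Fin n) ℂ) x)
      (Matrix.toEuclideanLin (g : Matrix (Fin n) (Fin n) ℂ) x) = inner ℂ x x := by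
    rw [← LinearMap.adjoint_inner_right, ← Matrix.toEuclideanLin_conjTranspose_eq_adjoint]
    congr 1
    have := g.2
    rw [Matrix.mem_unitaryGroup_iff', Matrix.star_eq_conjTranspose] at this
    ext i
    simp [Matrix.toLpLin_apply, Matrix.mulVec_mulVec, this]
  rw [inner_self_eq_norm_sq_to_K, inner_self_eq_norm_sq_to_K] at h
  have h' : ‖Matrix.toEuclideanLin (g : Matrix (Fin n) (Fin n) ℂ) x‖ ^ 2 = ‖x‖ ^ 2 := by
    exact_mod_cast h
  exact (sq_eq_sq₀ (norm_nonneg _) (norm_nonneg _)).1 h'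

open scoped Matrix.Norms.L2Operator in
lemma aux_exp_mem {n : ℕ} (M : Matrix (Fin n) (Fin n) ℂ) (hM : Mᴴ = -M) (s : ℝ) :
    NormedSpace.exp (s • M) ∈ Matrix.unitaryGroup (Fin n) ℂ := by
  letI : NormedAlgebra ℚ (Matrix (Fin n) (Fin n) ℂ) := NormedAlgebra.restrictScalars ℚ ℂ _
  refine NormedSpace.exp_mem_unitary_of_mem_skewAdjoint ?_
  rw [skewAdjoint.mem_iff, Matrix.star_eq_conjTranspose, Matrix.conjTranspose_smul, hM]
  simp

open scoped Matrix.Norms.L2Operator in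
lemma aux_W {n p : ℕ} (B : Fin p → Matrix (Fin n) (Fin n) ℂ) (hB : ∀ i, (B i)ᴴ = -(B i))
    (S : Subgroup (Matrix.unitaryGroup (Fin n) ℂ))
    (hS : ∀ g : Matrix.unitaryGroup (Fin n) ℂ, (∃ s : ℝ, ∃ i : Fin p,
      (g : Matrix (Fin n) (Fin n) ℂ) = NormedSpace.exp (s • B i)) → g ∈ S)
    (c : Fin p → ℝ) (l : List (Fin p)) :
    ∃ W : ℝ → S, W 0 = 1 ∧
      HasDerivAt (fun h => ((W h : Matrix.unitaryGroup (Fin n) ℂ) : Matrix (Fin n) (Fin n) ℂ))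
        ((l.map fun i => c i • B i).sum) 0 := by
  induction l with
  | nil => exact ⟨fun _ => 1, rfl, by simpa using hasDerivAt_const (0:ℝ) _⟩
  | cons i l ih =>
    obtain ⟨W, hW0, hW⟩ := ih
    let E : ℝ → S := fun h => ⟨⟨NormedSpace.exp ((h * c i) • B i), aux_exp_mem _ (hB i) _⟩,
      hS _ ⟨h * c i, i, rfl⟩⟩
    have hE0 : E 0 = 1 := by
      apply Subtype.ext; apply Subtype.ext
      simp [E]
    have hE : HasDerivAt (fun h => ((E h : Matrix.unitaryGroup (Fin n) ℂ) :
        Matrix (Fin n) (Fin n) ℂ)) (c i • B i) 0 := by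
      have := hasDerivAt_exp_smul_const (𝕂 := ℝ) (c i • B i) (0:ℝ)
      simpa [E, smul_smul] using this
    refine ⟨fun h => E h * W h, by simp [hE0, hW0], ?_⟩
    have := hE.mul hW
    rw [hE0, hW0] at this
    simp only [OneMemClass.coe_one, mul_one, one_mul] at this
    simpa only [List.map_cons, List.sum_cons] using! this

open scoped Matrix.Norms.L2Operator in
lemma aux_prod_deriv {n p : ℕ} (B : Fin p → Matrix (Fin n) (Fin n) ℂ) (c : Fin p → ℝ)
    (X : ℝ → EuclideanSpace ℂ (Fin n)) (A : Matrix (Fin n) (Fin n) ℂ)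
    (W : ℝ → Matrix (Fin n) (Fin n) ℂ) (t : ℝ)
    (hW : HasDerivAt W (((List.finRange p).map fun i => (- c i) • B i).sum) 0) (hW0 : W 0 = 1)
    (hX : HasDerivAt X
      (Matrix.toEuclideanLin A (X t) + ∑ i, c i • Matrix.toEuclideanLin (B i) (X t)) t) :
    HasDerivAt (fun h => Matrix.toEuclideanLin (W h) (X (t + h)))
      (Matrix.toEuclideanLin A (X t)) 0 := by
  let L : Matrix (Fin n) (Fin n) ℂ →ₗ[ℝ] EuclideanSpace ℂ (Fin n) →L[ℝ] EuclideanSpace ℂ (Fin n) :=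
    { toFun := fun M => (Matrix.toEuclideanCLM (𝕜 := ℂ) M).restrictScalars ℝ
      map_add' := fun M N => by ext; simp
      map_smul' := fun r M => by
        ext x i
        simp [← Complex.coe_smul] }
  have hL : ∀ M x, L M x = Matrix.toEuclideanLin M x := fun M x => rfl
  have h1 : HasDerivAt (fun h => L (W h)) (L (((List.finRange p).map fun i => (- c i) • B i).sum)) 0 :=
    (LinearMap.toContinuousLinearMap L).hasFDerivAt.comp_hasDerivAt (0:ℝ) hW
  have h2 : HasDerivAt (fun h => X (t + h))
      (Matrix.toEuclideanLin A (X t) + ∑ i, c i • Matrix.toEuclideanLin (B i) (X t)) 0 := by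
    have : HasDerivAt X
      (Matrix.toEuclideanLin A (X t) + ∑ i, c i • Matrix.toEuclideanLin (B i) (X t)) (t + 0) := by
      simpa using hX
    exact this.comp_const_add t 0
  have h3 := h1.clm_apply h2
  convert! h3 using 1
  rw [hW0, ← Fin.sum_univ_def, map_sum, ContinuousLinearMap.sum_apply]
  simp only [map_smul, ContinuousLinearMap.smul_apply, hL, add_zero]
  simp

/-- Consider the quantum control system `Ẋ = AX + ∑ᵢ uᵢ(t) Bᵢ X` on the unit sphere
of `ℂⁿ`, with skew-Hermitian matrices `A, B₁, …, B_p`, `‖A‖ ≤ 1` (operator norm),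
continuous controls `u`, and a differentiable trajectory `X` with `‖X 0‖ = 1`.
Let `G` be the topological closure in `U(n)` of the subgroup generated by the
one-parameter groups `exp(s Bᵢ)`. Then for every `0 ≤ T ≤ π`,
`inf_{g ∈ G} ‖g X(0) − X(T)‖ ≤ 2 sin(T/2)`. -/
theorem orbit_dist_le_two_sin_half_time (n p : ℕ) (hn : 1 ≤ n) (hp : 1 ≤ p)
    (A : Matrix (Fin n) (Fin n) ℂ) (B : Fin p → Matrix (Fin n) (Fin n) ℂ)
    (hA : Aᴴ = -A) (hB : ∀ i, (B i)ᴴ = -(B i))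
    (hAnorm : ‖Matrix.toEuclideanCLM (𝕜 := ℂ) A‖ ≤ 1)
    (u : ℝ → Fin p → ℝ) (hu : Continuous u)
    (X : ℝ → EuclideanSpace ℂ (Fin n)) (hX0 : ‖X 0‖ = 1)
    (hX : ∀ t : ℝ, HasDerivAt X
      (Matrix.toEuclideanLin A (X t) + ∑ i, u t i • Matrix.toEuclideanLin (B i) (X t)) t)
    (G : Set (Matrix.unitaryGroup (Fin n) ℂ))
    (hG : G = closure (↑(Subgroup.closure {g : Matrix.unitaryGroup (Fin n) ℂ |
      ∃ s : ℝ, ∃ i : Fin p, (g : Matrix (Fin n) (Fin n) ℂ) = NormedSpace.exp (s • B i)})))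
    (T : ℝ) (hT0 : 0 ≤ T) (hTpi : T ≤ Real.pi) :
    sInf {r : ℝ | ∃ g ∈ G,
        r = ‖Matrix.toEuclideanLin (g : Matrix (Fin n) (Fin n) ℂ) (X 0) - X T‖}
      ≤ 2 * Real.sin (T / 2) := by
  have hXn : ∀ t, ‖X t‖ = 1 := by
    have hder : ∀ t, HasDerivAt (fun t => ‖X t‖ ^ 2) 0 t := by
      intro t
      letI : InnerProductSpace ℝ (EuclideanSpace ℂ (Fin n)) := InnerProductSpace.rclikeToReal ℂ _
      have h := (hX t).norm_sq
      convert! h using 1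
      symm
      rw [mul_eq_zero]
      right
      rw [real_inner_eq_re_inner ℂ, inner_add_right, inner_sum]
      simp only [map_add, map_sum]
      have h0 := aux_inner_skew A hA (X t)
      have h2 : ∀ i, RCLike.re (inner ℂ (X t)
          (u t i • Matrix.toEuclideanLin (B i) (X t))) = 0 := by
        intro i
        have h3 := aux_inner_skew (B i) (hB i) (X t)
        rw [inner_smul_right_eq_smul]
        simp [h3]
      rw [Finset.sum_eq_zero (fun i _ => h2 i), add_zero]
      exact h0
    intro t
    have h := is_const_of_deriv_eq_zero (fun t => (hder t).differentiableAt)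
      (fun t => (hder t).deriv) t 0
    simp only [hX0] at h
    exact (sq_eq_sq₀ (norm_nonneg _) zero_le_one).1 h
  have hXc : Continuous X := continuous_iff_continuousAt.2 fun t => (hX t).continuousAt
  set S := Subgroup.closure {g : Matrix.unitaryGroup (Fin n) ℂ |
      ∃ s : ℝ, ∃ i : Fin p, (g : Matrix (Fin n) (Fin n) ℂ) = NormedSpace.exp (s • B i)} with hS
  let ρ : S → EuclideanSpace ℂ (Fin n) → EuclideanSpace ℂ (Fin n) := fun g x =>
    Matrix.toEuclideanLin ((g : Matrix.unitaryGroup (Fin n) ℂ) : Matrix (Fin n) (Fin n) ℂ) x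
  have hnorm : ∀ g x, ‖ρ g x‖ = ‖x‖ := fun g x => aux_norm_unitary _ x
  have hcore := aux_core ρ (fun x => by simp [ρ])
    (fun g h x => by
      ext i
      simp [ρ, Matrix.toLpLin_apply, Matrix.mulVec_mulVec])
    (fun g x y => by
      rw [← hnorm g (x - y)]; simp [ρ, map_sub])
    hnorm X hXn hXc ?_ T hT0
  · set s := sInf {r : ℝ | ∃ g ∈ G,
        r = ‖Matrix.toEuclideanLin (g : Matrix (Fin n) (Fin n) ℂ) (X 0) - X T‖} with hs
    have hle : 2 * Real.arcsin (s / 2) ≤ T := by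
      refine le_trans (le_ciInf fun g => ?_) hcore
      rw [aux_angle_eq (by rw [hnorm, hX0]) (hXn T)]
      have : s ≤ ‖ρ g (X 0) - X T‖ := by
        refine csInf_le ⟨0, ?_⟩ ⟨g, ?_, rfl⟩
        · rintro _ ⟨g, _, rfl⟩
          exact norm_nonneg _
        · rw [hG]
          exact subset_closure g.2
      have := Real.monotone_arcsin (show s / 2 ≤ ‖ρ g (X 0) - X T‖ / 2 by linarith)
      linarith
    have hs0 : 0 ≤ s := Real.sInf_nonneg (by rintro _ ⟨g, _, rfl⟩; exact norm_nonneg _)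
    have hs2 : s ≤ 2 := by
      have h5 : s ≤ ‖ρ 1 (X 0) - X T‖ := by
        refine csInf_le ⟨0, ?_⟩ ⟨(1 : S), ?_, rfl⟩
        · rintro _ ⟨g, _, rfl⟩
          exact norm_nonneg _
        · rw [hG]
          exact subset_closure (1 : S).2
      refine h5.trans ((norm_sub_le _ _).trans ?_)
      rw [hnorm, hX0, hXn]
      norm_num
    have h4 : s / 2 ≤ Real.sin (T / 2) :=
      (Real.arcsin_le_iff_le_sin ⟨by linarith, by linarith⟩
        ⟨by linarith [Real.pi_pos], by linarith⟩).1 (by linarith)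
    linarith
  · intro t
    obtain ⟨W, hW0, hW⟩ := aux_W B hB S (fun g hg => Subgroup.subset_closure hg)
      (fun i => - u t i) (List.finRange p)
    refine ⟨W, Matrix.toEuclideanLin A (X t), ?_, hW0, ?_⟩
    · have := (Matrix.toEuclideanCLM (𝕜 := ℂ) A).le_opNorm (X t)
      rw [hXn, mul_one] at this
      exact this.trans hAnorm
    · exact aux_prod_deriv _ _ X _ _ t hW (by simp [hW0]) (hX t)
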